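/- Let F_q be a finite field and let d_{n,i} (0 ≤ i ≤ n−1) be the Dickson invariants of GL_n(F_q) acting on V = F_qⁿ. Then the determinant of the Jacobian matrix J(d_{n,0},...,d_{n,n−1}) equals, up to a nonzero scalar, ∏_{H} l_H^{(n−1)(q−1)+(q−2)}, the product ranging over all hyperplanes H ≤ V with defining linear forms l_H, and in particular the exterior derivatives d(d_{n,0}),...,d(d_{n,n−1}) generate (Ω¹)^{GL_n(F_q)} as a free module over the Dickson algebra F_q[V]^{GL_n(F_q)}. -/

import Mathlib

open MvPolynomial

abbrev GLn (F : Type*) [Field F] (n : ℕ) := (Fin n → F) ≃ₗ[F] (Fin n → F)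

variable {F : Type*} [Field F] {n : ℕ}

/-- Matrix of the contragredient action of `g` on the coordinate functions:
`g · z_i = ∑ j (actMat g i j) z_j`. -/
noncomputable def actMat (g : GLn F n) : Matrix (Fin n) (Fin n) F :=
  Matrix.of fun i j => g.symm (Pi.single j 1) i

/-- Action of `g ∈ GL(V)` on polynomials `F[V]` (contragredient action). -/
noncomputable def polyAct (g : GLn F n) : MvPolynomial (Fin n) F →ₐ[F] MvPolynomial (Fin n) F :=
  aeval fun i => ∑ j, C (actMat g i j) * X j

/-- The degree-one polynomial corresponding to a linear form on `V`. -/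
noncomputable def linToPoly (z : (Fin n → F) →ₗ[F] F) : MvPolynomial (Fin n) F :=
  ∑ j, C (z (Pi.single j 1)) * X j

/-- The invariant ring `F[V]^G` as a subalgebra of `F[V]`. -/
noncomputable def invSub (G : Subgroup (GLn F n)) : Subalgebra F (MvPolynomial (Fin n) F) where
  carrier := {f | ∀ g ∈ G, polyAct g f = f}
  add_mem' := fun {a b} ha hb g hg => by rw [map_add, ha g hg, hb g hg]
  mul_mem' := fun {a b} ha hb g hg => by rw [map_mul, ha g hg, hb g hg]
  algebraMap_mem' := fun r g hg => (polyAct g).commutes r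

/-- Action of `g` on a differential 1-form `ω = ∑ i (w i) dz_i`; the result is the
coefficient vector of `g · ω`. -/
noncomputable def oneFormAct (g : GLn F n) (w : Fin n → MvPolynomial (Fin n) F) :
    Fin n → MvPolynomial (Fin n) F :=
  fun j => ∑ i, polyAct g (w i) * C (actMat g i j)

/-- The coefficient of `dz_J` in `g · dz_I` (a minor determinant of `actMat g`). -/
noncomputable def minorDet (g : GLn F n) (I J : Finset (Fin n)) : F :=
  if h : J.card = I.card then
    Matrix.det (Matrix.of fun a b : Fin I.card =>
      actMat g (I.orderIsoOfFin rfl a) (J.orderIsoOfFin h b))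
  else 0

/-- Action of `g` on a differential form `μ = ∑_I u_I dz_I`, given by its coefficient
function `u : Finset (Fin n) → F[V]`. -/
noncomputable def formAct (g : GLn F n) (u : Finset (Fin n) → MvPolynomial (Fin n) F) :
    Finset (Fin n) → MvPolynomial (Fin n) F :=
  fun J => ∑ I : Finset (Fin n), polyAct g (u I) * C (minorDet g I J)

/-- The sign arising when wedging `dz_I ∧ dz_J` into `dz_(I ∪ J)` for disjoint `I`, `J`. -/
def wsign (I J : Finset (Fin n)) : ℤ :=
  (-1) ^ ((I ×ˢ J).filter fun p => p.2 < p.1).card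

/-- Wedge product of differential forms in terms of coefficient functions. -/
noncomputable def wedgeF (u v : Finset (Fin n) → MvPolynomial (Fin n) F) :
    Finset (Fin n) → MvPolynomial (Fin n) F :=
  fun K => ∑ I ∈ K.powerset, wsign I (K \ I) • (u I * v (K \ I))

/-- The constant 0-form `1`. -/
noncomputable def unitForm : Finset (Fin n) → MvPolynomial (Fin n) F :=
  fun S => if S = ∅ then 1 else 0

/-- Iterated wedge product of a list of forms. -/
noncomputable def iterWedge (L : List (Finset (Fin n) → MvPolynomial (Fin n) F)) :
    Finset (Fin n) → MvPolynomial (Fin n) F :=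
  L.foldr wedgeF unitForm

/-- A 1-form, viewed as a differential form via its coefficient function. -/
noncomputable def oneToForm (w : Fin n → MvPolynomial (Fin n) F) :
    Finset (Fin n) → MvPolynomial (Fin n) F :=
  fun S => if h : S.card = 1 then w (S.min' (Finset.card_pos.mp (by omega))) else 0

/-- The fixed space of `g` in `V`. -/
noncomputable def fixedSpace (g : GLn F n) : Submodule F (Fin n → F) :=
  LinearMap.ker (g.toLinearMap - LinearMap.id)

/-- A reflection: an element of finite order whose fixed space is a hyperplane. -/
def IsReflection (g : GLn F n) : Prop :=
  IsOfFinOrder g ∧ Module.finrank F (fixedSpace g) = n - 1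

/-- A transvection: a (necessarily nondiagonalizable) reflection of determinant one. -/
def IsTransvection (g : GLn F n) : Prop :=
  IsReflection g ∧ LinearMap.det g.toLinearMap = 1 ∧ g ≠ 1

/-- The pointwise stabilizer `G_H` of a subspace `H` in `G`. -/
def pointStab (G : Subgroup (GLn F n)) (H : Submodule F (Fin n → F)) : Subgroup (GLn F n) where
  carrier := {g | g ∈ G ∧ ∀ v ∈ H, g v = v}
  one_mem' := ⟨G.one_mem, fun v _ => rfl⟩
  mul_mem' := fun {a b} ha hb => ⟨G.mul_mem ha.1 hb.1, fun v hv => by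
    show a (b v) = v
    rw [hb.2 v hv, ha.2 v hv]⟩
  inv_mem' := fun {a} ha => ⟨G.inv_mem ha.1, fun v hv => by
    show a.symm v = v
    conv_lhs => rw [← ha.2 v hv]
    exact a.symm_apply_apply v⟩

/-- `K_H`: the subgroup of `G_H` of elements of determinant one
(the transvections in `G_H` together with the identity). -/
noncomputable def KH (G : Subgroup (GLn F n)) (H : Submodule F (Fin n → F)) :
    Subgroup (GLn F n) :=
  pointStab G H ⊓ MonoidHom.ker LinearEquiv.det

/-- `e_H = |G_H : K_H|`. -/
noncomputable def eH (G : Subgroup (GLn F n)) (H : Submodule F (Fin n → F)) : ℕ :=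
  ((KH G H).subgroupOf (pointStab G H)).index

/-- The transvection root space of `G_H`: the span of the root vectors of the
transvections in `G_H` (the root vector of `t` spans the range of `t - 1`). -/
noncomputable def trvSpace (G : Subgroup (GLn F n)) (H : Submodule F (Fin n → F)) :
    Submodule F (Fin n → F) :=
  ⨆ g ∈ {g : GLn F n | g ∈ pointStab G H ∧ IsTransvection g},
    LinearMap.range (g.toLinearMap - LinearMap.id)

/-- `b_H`: the dimension of the transvection root space of `G_H`. -/
noncomputable def bH (G : Subgroup (GLn F n)) (H : Submodule F (Fin n → F)) : ℕ :=
  Module.finrank F (trvSpace G H)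

/-- The Dickson invariant `d_{n,i} = ∑_{W ≤ V, codim W = i} ∏_{φ ∈ V*, φ|_W ≠ 0} φ`. -/
noncomputable def dickson (F : Type*) [Field F] [Fintype F] (n : ℕ) (i : Fin n) :
    MvPolynomial (Fin n) F :=
  ∑ᶠ (W : Submodule F (Fin n → F)) (_ : Module.finrank F W = n - (i : ℕ)),
    ∏ᶠ (φ : Module.Dual F (Fin n → F)) (_ : ¬ W ≤ LinearMap.ker φ), linToPoly φ

section AdditivePolynomial

open Finset

variable {K : Type*} [Fintype F] [Field K] [Algebra F K]

lemma add_pow_card (x y : K) : (x + y) ^ Fintype.card F = x ^ Fintype.card F + y ^ Fintype.card F :=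
  map_add (FiniteField.frobeniusAlgHom F K) x y

lemma sum_pow_card {ι : Type*} (s : Finset ι) (f : ι → K) :
    (∑ i ∈ s, f i) ^ Fintype.card F = ∑ i ∈ s, f i ^ Fintype.card F :=
  map_sum (FiniteField.frobeniusAlgHom F K) f s

lemma smul_pow_card (a : F) (y : K) : (a • y) ^ Fintype.card F = a • y ^ Fintype.card F :=
  map_smul (FiniteField.frobeniusAlgHom F K) a y

lemma prod_X_add_C_eq :
    ∏ a : F, (Polynomial.X + Polynomial.C (algebraMap F K a)) =
      Polynomial.X ^ Fintype.card F - Polynomial.X := by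
  have hq : 1 < Fintype.card F := Fintype.one_lt_card
  have hmonic : (Polynomial.X ^ Fintype.card F - Polynomial.X : Polynomial F).Monic :=
    Polynomial.monic_X_pow_sub (by simpa using hq)
  have h := Polynomial.prod_multiset_X_sub_C_of_monic_of_roots_card_eq hmonic (by
    rw [FiniteField.roots_X_pow_card_sub_X, FiniteField.X_pow_card_sub_X_natDegree_eq F hq]
    rfl)
  rw [FiniteField.roots_X_pow_card_sub_X] at h
  have h' : ∏ a : F, (Polynomial.X - Polynomial.C a) =
      Polynomial.X ^ Fintype.card F - Polynomial.X := h
  have h'' := congrArg (Polynomial.map (algebraMap F K)) h'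
  simp only [Polynomial.map_prod, Polynomial.map_sub, Polynomial.map_X, Polynomial.map_C,
    Polynomial.map_pow] at h''
  rw [← h'']
  exact Fintype.prod_equiv (Equiv.neg F) _ _ fun a => by simp

lemma prod_add_algebraMap (b : K) :
    ∏ a : F, (b + algebraMap F K a) = b ^ Fintype.card F - b := by
  simpa [Polynomial.eval_prod] using
    congrArg (Polynomial.eval b) (prod_X_add_C_eq (F := F) (K := K))

lemma prod_add_smul (x y : K) :
    ∏ a : F, (x + a • y) =
      x ^ Fintype.card F - y ^ (Fintype.card F - 1) * x := by
  have hq : 1 < Fintype.card F := Fintype.one_lt_card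
  by_cases hy : y = 0
  · simp [hy, Finset.prod_const, zero_pow (Nat.sub_ne_zero_of_lt hq)]
  · have h1 : ∀ a : F, x + a • y = y * (x / y + algebraMap F K a) := fun a => by
      rw [Algebra.smul_def]; field_simp
    simp_rw [h1]
    rw [Finset.prod_mul_distrib, prod_add_algebraMap, Finset.prod_const, Finset.card_univ]
    obtain ⟨k, hk⟩ : ∃ k, Fintype.card F = k + 1 := ⟨_, (Nat.succ_pred_eq_of_pos (by omega)).symm⟩
    obtain ⟨z, rfl⟩ : ∃ z, x = y * z := ⟨x / y, by field_simp⟩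
    rw [hk, Nat.add_sub_cancel, mul_div_cancel_left₀ _ hy]
    ring

lemma sum_inv_add_algebraMap (c : K) (hc : c ^ Fintype.card F - c ≠ 0) :
    ∑ a : F, (c + algebraMap F K a)⁻¹ = -(c ^ Fintype.card F - c)⁻¹ := by
  classical
  have h := congrArg (fun p => Polynomial.eval c (Polynomial.derivative p))
    (prod_X_add_C_eq (F := F) (K := K))
  have hq : ((Fintype.card F : ℕ) : K) = 0 := by
    rw [← map_natCast (algebraMap F K), FiniteField.cast_card_eq_zero, map_zero]
  have hne : ∀ a : F, c + algebraMap F K a ≠ 0 := fun a ha => hc <| by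
    rw [← prod_add_algebraMap (F := F)]
    exact Finset.prod_eq_zero (mem_univ a) ha
  simp only [Polynomial.derivative_prod_finset, Polynomial.derivative_add, Polynomial.derivative_X,
    Polynomial.derivative_C, add_zero, mul_one, Polynomial.eval_finsetSum, Polynomial.eval_prod,
    Polynomial.eval_add, Polynomial.eval_X, Polynomial.eval_C, Polynomial.derivative_sub,
    Polynomial.derivative_X_pow, hq, map_zero, zero_mul, zero_sub, Polynomial.eval_neg,
    Polynomial.eval_one] at h
  have h2 : ∀ a : F, (c + algebraMap F K a)⁻¹ =
      (∏ b ∈ univ.erase a, (c + algebraMap F K b)) * (c ^ Fintype.card F - c)⁻¹ := fun a => by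
    rw [← prod_add_algebraMap (F := F), ← Finset.mul_prod_erase univ _ (mem_univ a), mul_inv,
      mul_left_comm, mul_inv_cancel₀, mul_one]
    exact Finset.prod_ne_zero_iff.mpr fun b _ => hne b
  rw [Finset.sum_congr rfl fun a _ => h2 a, ← Finset.sum_mul, h]
  ring

lemma sum_one_sub_pow (b : K) :
    ∑ a : F, (1 - (b + algebraMap F K a) ^ (Fintype.card F - 1)) ^ (Fintype.card F - 1) = 1 := by
  classical
  have hq : 1 < Fintype.card F := Fintype.one_lt_card
  have hq0 : ((Fintype.card F : ℕ) : K) = 0 := by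
    rw [← map_natCast (algebraMap F K), FiniteField.cast_card_eq_zero, map_zero]
  obtain ⟨k, hk⟩ : ∃ k, Fintype.card F = k + 1 := ⟨_, (Nat.succ_pred_eq_of_pos (by omega)).symm⟩
  have hk0 : k ≠ 0 := by omega
  by_cases hs : b ^ Fintype.card F - b = 0
  · rw [← prod_add_algebraMap (F := F), Finset.prod_eq_zero_iff] at hs
    obtain ⟨a₀, -, ha₀⟩ := hs
    rw [Finset.sum_eq_single a₀]
    · rw [ha₀, hk, Nat.add_sub_cancel, zero_pow hk0, sub_zero, one_pow]
    · intro a _ ha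
      have : b + algebraMap F K a = algebraMap F K (a - a₀) := by
        rw [map_sub]; linear_combination ha₀
      rw [this, ← map_pow, FiniteField.pow_card_sub_one_eq_one _ (sub_ne_zero.mpr ha), map_one,
        sub_self, hk, Nat.add_sub_cancel, zero_pow hk0]
    · simp
  · set s := b ^ Fintype.card F - b with hsdef
    have hpow : ∀ a : F, (b + algebraMap F K a) ^ Fintype.card F
        = b ^ Fintype.card F + algebraMap F K a := fun a => by
      rw [add_pow_card, ← map_pow, FiniteField.pow_card]
    have hne : ∀ a : F, b + algebraMap F K a ≠ 0 := fun a ha => hs <| by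
      rw [hsdef, ← prod_add_algebraMap (F := F)]
      exact Finset.prod_eq_zero (mem_univ a) ha
    have hsq : (b ^ Fintype.card F) ^ Fintype.card F - b ^ Fintype.card F = s ^ Fintype.card F := by
      exact (map_sub (FiniteField.frobeniusAlgHom F K) (b ^ Fintype.card F) b).symm
    have hterm : ∀ a : F,
        (1 - (b + algebraMap F K a) ^ (Fintype.card F - 1)) ^ (Fintype.card F - 1) =
          (-s) ^ k * (1 - s * (b ^ Fintype.card F + algebraMap F K a)⁻¹) := fun a => by
      rw [← hpow]
      have hy := hne a
      have hsy : s = (b + algebraMap F K a) ^ Fintype.card F - (b + algebraMap F K a) := by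
        rw [hpow]; ring
      generalize b + algebraMap F K a = y at hy hsy
      rw [hsy, hk, Nat.add_sub_cancel]
      have : -(y ^ (k + 1) - y) = y * (1 - y ^ k) := by ring
      rw [this, mul_pow]
      field_simp
      ring
    rw [Finset.sum_congr rfl fun a _ => hterm a, ← Finset.mul_sum, Finset.sum_sub_distrib,
      ← Finset.mul_sum, sum_inv_add_algebraMap, hsq, Finset.sum_const, card_univ, nsmul_eq_mul,
      hq0, hk]
    · have : (-1 : K) ^ k = 1 := by
        have := FiniteField.pow_card_sub_one_eq_one (-1 : F) (by simp)
        rw [hk, Nat.add_sub_cancel] at this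
        simpa using congrArg (algebraMap F K) this
      rw [neg_pow, this]
      field_simp
      ring
    · rw [hsq]; exact pow_ne_zero _ hs

lemma sum_pow_sub_pow (x y : K) :
    ∑ a : F, (x ^ Fintype.card F - (y + a • x) ^ (Fintype.card F - 1) * x) ^ (Fintype.card F - 1) =
      x ^ ((Fintype.card F - 1) * Fintype.card F) := by
  have hq : 1 < Fintype.card F := Fintype.one_lt_card
  obtain ⟨k, hk⟩ : ∃ k, Fintype.card F = k + 1 := ⟨_, (Nat.succ_pred_eq_of_pos (by omega)).symm⟩
  have hk0 : k ≠ 0 := by omega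
  by_cases hx : x = 0
  · simp [hx, hk, hk0]
  · have := sum_one_sub_pow (F := F) (y / x)
    have h1 : ∀ a : F, (x ^ Fintype.card F - (y + a • x) ^ (Fintype.card F - 1) * x) ^
        (Fintype.card F - 1) = x ^ ((Fintype.card F - 1) * Fintype.card F) *
        (1 - (y / x + algebraMap F K a) ^ (Fintype.card F - 1)) ^ (Fintype.card F - 1) :=
        fun a => by
      have : y + a • x = x * (y / x + algebraMap F K a) := by
        rw [Algebra.smul_def]; field_simp
      rw [this, mul_comm (Fintype.card F - 1), pow_mul, ← mul_pow, hk, Nat.add_sub_cancel]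
      congr 1
      rw [mul_pow]
      ring
    rw [Finset.sum_congr rfl fun a _ => h1 a, ← Finset.mul_sum, this, mul_one]

/-- The product of all translates of `T` by the span of the family `a`. -/
noncomputable def spanProd (F : Type*) {K : Type*} [Field F] [Fintype F] [Field K] [Algebra F K]
    {m : ℕ} (a : Fin m → K) (T : K) : K :=
  ∏ c : Fin m → F, (T + ∑ j, c j • a j)

lemma spanProd_zero (a : Fin 0 → K) (T : K) : spanProd F a T = T := by
  simp [spanProd]

lemma spanProd_succ_eq_prod {m : ℕ} (a : Fin (m + 1) → K) (T : K) :
    spanProd F a T = ∏ b : F, spanProd F (fun j => a j.succ) (T + b • a 0) := by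
  unfold spanProd
  rw [← Fintype.prod_prod_type']
  refine (Fintype.prod_equiv (Fin.consEquiv fun _ => F) _ _ ?_).symm
  rintro ⟨b, c⟩
  simp [Fin.sum_univ_succ, add_assoc]

lemma spanProd_add_smul {m : ℕ} (a : Fin m → K) (T S : K) (b : F) :
    spanProd F a (T + b • S) = spanProd F a T + b • spanProd F a S := by
  induction m generalizing T S b with
  | zero => simp [spanProd_zero]
  | succ m ih =>
    simp_rw [spanProd_succ_eq_prod, ih, prod_add_smul, add_pow_card, smul_pow_card,
      Algebra.smul_def]
    ring

lemma spanProd_succ {m : ℕ} (a : Fin (m + 1) → K) (T : K) :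
    spanProd F a T = spanProd F (fun j => a j.succ) T ^ Fintype.card F -
      spanProd F (fun j => a j.succ) (a 0) ^ (Fintype.card F - 1) *
        spanProd F (fun j => a j.succ) T := by
  simp_rw [spanProd_succ_eq_prod, spanProd_add_smul, prod_add_smul]

lemma sum_spanProd_pow {m : ℕ} (u : Fin m → K) (ψ : K) :
    ∑ c : Fin m → F, spanProd F (fun j => u j + c j • ψ) ψ ^ (Fintype.card F - 1) =
      ψ ^ ((Fintype.card F - 1) * Fintype.card F ^ m) := by
  induction m with
  | zero => simp [spanProd_zero]
  | succ m ih =>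
    rw [← (Fin.consEquiv fun _ => F).sum_comp, Fintype.sum_prod_type_right]
    simp_rw [spanProd_succ]
    simp only [Fin.consEquiv_apply, Fin.cons_succ, Fin.cons_zero, spanProd_add_smul,
      sum_pow_sub_pow, pow_mul]
    simp_rw [← sum_pow_card, ih]
    rw [← pow_mul, ← pow_mul, pow_succ, mul_assoc]

end AdditivePolynomial

section SubspaceSum

open Finset

variable {U : Type*} [AddCommGroup U] [Module F U]

lemma exists_basis_fin_zero_eq [FiniteDimensional F U] {m : ℕ} (hU : Module.finrank F U = m + 1)
    {ψ : U} (hψ : ψ ≠ 0) : ∃ b : Module.Basis (Fin (m + 1)) F U, b 0 = ψ := by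
  obtain ⟨f, hf⟩ : ∃ f : Module.Dual F U, f ψ ≠ 0 := by
    by_contra! h
    exact hψ ((Module.forall_dual_apply_eq_zero_iff F ψ).mp h)
  have hf0 : f ≠ 0 := fun h => hf (by simp [h])
  have hN : Module.finrank F (LinearMap.ker f) = m := by
    have := Module.Dual.finrank_ker_add_one_of_ne_zero hf0
    omega
  refine ⟨Module.Basis.mkFinCons ψ (Module.finBasisOfFinrankEq F _ hN) ?_ ?_, by
    rw [Module.Basis.coe_mkFinCons, Fin.cons_zero]⟩
  · intro c x hx h
    have := congrArg f h
    rw [map_add, map_smul, LinearMap.mem_ker.mp hx, add_zero, map_zero, smul_eq_mul] at this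
    exact (mul_eq_zero.mp this).resolve_right hf
  · intro z
    refine ⟨-(f z / f ψ), ?_⟩
    rw [LinearMap.mem_ker, map_add, map_smul, smul_eq_mul]
    field_simp
    ring

variable {K Φ : Type*} [Fintype F] [Field K] [Algebra F K] [AddCommGroup Φ] [Module F Φ]

open Classical in
lemma prod_apply_ne_zero_eq_spanProd [Fintype U] {m : ℕ} (b : Module.Basis (Fin (m + 1)) F U)
    (ι : U →ₗ[F] K) (f : Module.Dual F U) (hf : f (b 0) = 1) :
    ∏ u ∈ univ.filter (fun u => f u ≠ 0), ι u =
      -spanProd F (fun j => ι (b (Fin.succ j)) + (-f (b j.succ)) • ι (b 0)) (ι (b 0)) ^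
        (Fintype.card F - 1) := by
  have hrepr : ∀ u : U, u = f u • b 0 + ∑ j : Fin m, b.repr u j.succ •
      (b j.succ + (-f (b j.succ)) • b 0) := by
    intro u
    have h := b.sum_repr u
    rw [Fin.sum_univ_succ] at h
    have hfu : f u = b.repr u 0 + ∑ j : Fin m, b.repr u j.succ * f (b j.succ) := by
      conv_lhs => rw [← h]
      simp [hf]
    conv_lhs => rw [← h]
    rw [hfu]
    simp only [smul_add, neg_smul, smul_neg, Finset.sum_add_distrib, add_smul, Finset.sum_smul,
      mul_smul, Finset.sum_neg_distrib]
    abel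
  have key : ∏ p : Fˣ × (Fin m → F), ι ((p.1 : F) • (b 0 + ∑ j : Fin m, p.2 j •
      (b j.succ + (-f (b j.succ)) • b 0))) = ∏ u ∈ univ.filter (fun u => f u ≠ 0), ι u := by
    have hfv : ∀ c : Fin m → F, f (b 0 + ∑ j : Fin m, c j •
      (b j.succ + (-f (b j.succ)) • b 0)) = 1 := fun c => by simp [hf]
    refine Finset.prod_bij (fun p _ => (p.1 : F) • (b 0 + ∑ j : Fin m, p.2 j •
      (b j.succ + (-f (b j.succ)) • b 0))) ?_ ?_ ?_ fun _ _ => rfl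
    · intro p _
      rw [mem_filter, map_smul, hfv]
      simp
    · rintro ⟨a, c⟩ - ⟨a', c'⟩ - h
      have ha : a = a' := by
        have := congrArg f h
        simp only [map_smul, hfv, smul_eq_mul, mul_one] at this
        exact Units.ext this
      subst ha
      have h2 := (smul_right_injective U (Units.ne_zero a)) h
      simp only [add_right_inj] at h2
      refine Prod.ext rfl (funext fun k => ?_)
      have := congrArg (fun u => b.repr u k.succ) h2
      simpa [Finsupp.single_apply, Fin.succ_ne_zero, (Fin.succ_ne_zero _).symm] using this
    · intro u hu
      have hu' : f u ≠ 0 := (mem_filter.mp hu).2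
      refine ⟨(Units.mk0 (f u) hu', fun j => (f u)⁻¹ * b.repr u j.succ), mem_univ _, ?_⟩
      conv_rhs => rw [hrepr u]
      simp only [Units.val_mk0, smul_add _ (b 0), Finset.smul_sum, mul_smul]
      simp_rw [smul_inv_smul₀ hu']
  rw [← key, Fintype.prod_prod_type]
  have hq : ∀ m : ℕ, (-1 : F) ^ (Fintype.card F ^ m) = -1 := fun m => FiniteField.pow_card_pow m _
  have h1 : ∀ a : Fˣ, ∏ c : Fin m → F, ι ((a : F) • (b 0 + ∑ j : Fin m, c j •
      (b j.succ + (-f (b j.succ)) • b 0))) = algebraMap F K a ^ (Fintype.card F ^ m) *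
      spanProd F (fun j => ι (b (Fin.succ j)) + (-f (b j.succ)) • ι (b 0)) (ι (b 0)) := fun a => by
    simp only [map_smul, map_add, map_sum, Algebra.smul_def (a : F), Finset.prod_mul_distrib,
      Finset.prod_const, spanProd]
    simp
  rw [Finset.prod_congr rfl fun a _ => h1 a, Finset.prod_mul_distrib, Finset.prod_const,
    Finset.card_univ, Fintype.card_units, Finset.prod_pow]
  have h2 : ∏ a : Fˣ, algebraMap F K a = algebraMap F K (-1) := by
    rw [← map_prod, ← Units.coe_prod, FiniteField.prod_univ_units_id_eq_neg_one]
    simp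
  rw [h2, ← map_pow, hq]
  simp

open Classical in
lemma sum_prod_apply_ne_zero [Fintype U] [Fintype (Module.Dual F U)] {m : ℕ}
    (hU : Module.finrank F U = m + 1) (ι : U →ₗ[F] K) {ψ : U} (hψ : ψ ≠ 0) :
    ∑ f ∈ univ.filter (fun f : Module.Dual F U => f ψ = 1),
      ∏ u ∈ univ.filter (fun u => f u ≠ 0), ι u =
      -ι ψ ^ ((Fintype.card F - 1) * Fintype.card F ^ m) := by
  obtain ⟨b, rfl⟩ := exists_basis_fin_zero_eq hU hψ
  rw [← sum_spanProd_pow (F := F) (fun j => ι (b (Fin.succ j))), ← Finset.sum_neg_distrib]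
  refine Finset.sum_nbij' (fun f j => -f (b j.succ))
    (fun c => b.constr F (Fin.cons 1 fun j => -c j)) ?_ ?_ ?_ ?_ ?_
  · simp
  · intro c _
    simp
  · intro f hf
    refine b.ext fun i => ?_
    refine Fin.cases ?_ (fun j => ?_) i
    · simpa [Module.Basis.constr_basis] using (mem_filter.mp hf).2.symm
    · simp
  · intro c _
    ext j
    simp
  · intro f hf
    exact prod_apply_ne_zero_eq_spanProd b ι f (mem_filter.mp hf).2

open Classical in
lemma sum_hyperplane_prod_compl [Fintype Φ] [Fintype (Submodule F Φ)] (ι : Φ →ₗ[F] K) {ψ : Φ}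
    (hψ : ψ ≠ 0) (U : Submodule F Φ) (hU : ψ ∈ U) :
    ∑ W ∈ univ.filter (fun W : Submodule F Φ => ψ ∉ W ∧ W ⊔ F ∙ ψ = U),
      (∏ φ ∈ univ.filter (· ∉ W), ι φ) * ι ψ ^ Fintype.card F ^ Module.finrank F W =
    -((∏ φ ∈ univ.filter (· ∉ U), ι φ) * ι ψ ^ Fintype.card F ^ Module.finrank F U) := by
  have : Finite (Module.Dual F U) := Module.finite_of_finite F
  let := Fintype.ofFinite (Module.Dual F U)
  set ψ' : U := ⟨ψ, hU⟩
  have hψ' : ψ' ≠ 0 := fun h => hψ (congrArg Subtype.val h)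
  have : Nontrivial U := ⟨⟨ψ', 0, hψ'⟩⟩
  obtain ⟨m, hm⟩ : ∃ m, Module.finrank F U = m + 1 :=
    ⟨_, (Nat.succ_pred_eq_of_pos Module.finrank_pos).symm⟩
  have hmem : ∀ (f : Module.Dual F U) (u : U),
      (u : Φ) ∈ (LinearMap.ker f).map U.subtype ↔ f u = 0 := fun f u => by
    rw [Submodule.mem_map]
    constructor
    · rintro ⟨v, hv, h⟩
      rwa [← Subtype.ext h]
    · exact fun h => ⟨u, h, rfl⟩
  have hterm : ∀ f : Module.Dual F U, f ψ' = 1 →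
      (∏ φ ∈ univ.filter (· ∉ U), ι φ) * ι ψ ^ Fintype.card F ^ m *
        (∏ u ∈ univ.filter (fun u : U => f u ≠ 0), (ι ∘ₗ U.subtype) u) =
      (∏ φ ∈ univ.filter (· ∉ (LinearMap.ker f).map U.subtype), ι φ) * ι ψ ^ Fintype.card F ^
        Module.finrank F ((LinearMap.ker f).map U.subtype) := by
    intro f hf
    have hf0 : f ≠ 0 := fun h => by simp [h] at hf
    have hrank : Module.finrank F ((LinearMap.ker f).map U.subtype) = m := by
      have := Module.Dual.finrank_ker_add_one_of_ne_zero hf0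
      rw [Submodule.finrank_map_subtype_eq]
      omega
    rw [hrank, mul_right_comm]
    congr 1
    have hprod : ∏ u ∈ univ.filter (fun u : U => f u ≠ 0), (ι ∘ₗ U.subtype) u =
        ∏ φ ∈ (univ.filter (fun u : U => f u ≠ 0)).map ⟨_, U.injective_subtype⟩, ι φ := by
      rw [Finset.prod_map]; rfl
    rw [hprod, ← Finset.prod_union]
    · refine Finset.prod_congr (Finset.ext fun φ => ?_) fun _ _ => rfl
      simp only [mem_union, mem_filter, mem_univ, true_and, mem_map, Function.Embedding.coeFn_mk,
        Submodule.subtype_apply]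
      constructor
      · rintro (h | ⟨u, hu, rfl⟩)
        · exact fun h' => h (Submodule.map_subtype_le _ _ h')
        · rwa [hmem]
      · intro h
        by_cases hφ : φ ∈ U
        · exact Or.inr ⟨⟨φ, hφ⟩, fun h0 => h ((hmem f ⟨φ, hφ⟩).mpr h0), rfl⟩
        · exact Or.inl hφ
    · rw [Finset.disjoint_left]
      intro φ hφ hφ'
      obtain ⟨u, -, rfl⟩ := mem_map.mp hφ'
      exact (mem_filter.mp hφ).2 u.2
  calc _ = ∑ f ∈ univ.filter (fun f : Module.Dual F U => f ψ' = 1),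
        (∏ φ ∈ univ.filter (· ∉ U), ι φ) * ι ψ ^ Fintype.card F ^ m *
        (∏ u ∈ univ.filter (fun u : U => f u ≠ 0), (ι ∘ₗ U.subtype) u) := by
        symm
        refine Finset.sum_bij (fun f _ => (LinearMap.ker f).map U.subtype) ?_ ?_ ?_ ?_
        · intro f hf
          have hf := (mem_filter.mp hf).2
          refine mem_filter.mpr ⟨mem_univ _, ?_, le_antisymm ?_ ?_⟩
          · rw [hmem f ψ', hf]; exact one_ne_zero
          · exact sup_le (Submodule.map_subtype_le _ _)
              ((Submodule.span_singleton_le_iff_mem _ _).mpr hU)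
          · intro u hu
            rw [Submodule.mem_sup]
            refine ⟨u - f ⟨u, hu⟩ • ψ, ?_, f ⟨u, hu⟩ • ψ,
              Submodule.smul_mem _ _ (Submodule.mem_span_singleton_self ψ), sub_add_cancel _ _⟩
            refine (hmem f (⟨u, hu⟩ - f ⟨u, hu⟩ • ψ')).mpr ?_
            rw [map_sub, map_smul, hf]
            simp
        · intro f hf g hg h
          have hf := (mem_filter.mp hf).2
          have hg := (mem_filter.mp hg).2
          refine LinearMap.ext fun u => ?_
          have h1 : f (u - f u • ψ') = 0 := by rw [map_sub, map_smul, hf]; simp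
          have h2 := (hmem f _).mpr h1
          rw [h, hmem, map_sub, map_smul, hg] at h2
          rw [smul_eq_mul, mul_one] at h2
          exact (sub_eq_zero.mp h2).symm
        · intro W hW
          obtain ⟨-, hψW, hW⟩ := mem_filter.mp hW
          obtain ⟨g, hg, hgW⟩ := Submodule.exists_le_ker_of_notMem hψW
          refine ⟨(g ψ)⁻¹ • g ∘ₗ U.subtype, mem_filter.mpr ⟨mem_univ _, ?_⟩, ?_⟩
          · simp [ψ', hg]
          · ext φ
            constructor
            · rintro ⟨u, hu, rfl⟩
              have hgu : g u = 0 := by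
                have : (g ψ)⁻¹ * g u = 0 := hu
                simpa [hg] using this
              have huU : (u : Φ) ∈ W ⊔ F ∙ ψ := hW ▸ u.2
              obtain ⟨w, hw, y, hy, hwy⟩ := Submodule.mem_sup.mp huU
              obtain ⟨a, rfl⟩ := Submodule.mem_span_singleton.mp hy
              have hgw : g w = 0 := hgW hw
              rw [← hwy, map_add, map_smul, hgw, zero_add, smul_eq_mul] at hgu
              have ha : a = 0 := (mul_eq_zero.mp hgu).resolve_right hg
              rw [Submodule.subtype_apply, ← hwy, ha, zero_smul, add_zero]
              exact hw
            · intro hφ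
              have hφU : φ ∈ U := hW ▸ Submodule.mem_sup_left hφ
              refine ⟨⟨φ, hφU⟩, ?_, rfl⟩
              have hgφ : g φ = 0 := hgW hφ
              simp [hgφ]
        · intro f hf
          exact hterm f (mem_filter.mp hf).2
    _ = _ := by
        rw [← Finset.mul_sum, sum_prod_apply_ne_zero hm (ι ∘ₗ U.subtype) hψ', hm]
        obtain ⟨k, hk⟩ : ∃ k, Fintype.card F = k + 1 :=
          ⟨_, (Nat.succ_pred_eq_of_pos Fintype.card_pos).symm⟩
        have : (ι ∘ₗ U.subtype) ψ' = ι ψ := rfl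
        rw [this, mul_neg, mul_assoc, ← pow_add, hk, Nat.add_sub_cancel]
        congr 3
        ring

open Classical in
theorem sum_submodule_prod_compl [Fintype Φ] [Fintype (Submodule F Φ)] (ι : Φ →ₗ[F] K) {ψ : Φ}
    (hψ : ψ ≠ 0) :
    ∑ U : Submodule F Φ,
      (∏ φ ∈ univ.filter (· ∉ U), ι φ) * ι ψ ^ Fintype.card F ^ Module.finrank F U = 0 := by
  rw [← Finset.sum_filter_add_sum_filter_not univ (fun U : Submodule F Φ => ψ ∈ U),
    ← Finset.sum_fiberwise_of_maps_to (s := univ.filter (fun U : Submodule F Φ => ψ ∉ U))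
      (t := univ.filter (fun U : Submodule F Φ => ψ ∈ U)) (g := fun W => W ⊔ F ∙ ψ),
    ← Finset.sum_add_distrib]
  · refine Finset.sum_eq_zero fun U hU => ?_
    rw [Finset.filter_filter, sum_hyperplane_prod_compl ι hψ U (mem_filter.mp hU).2,
      add_neg_cancel]
  · intro W _
    exact mem_filter.mpr ⟨mem_univ _,
      Submodule.mem_sup_right (Submodule.mem_span_singleton_self ψ)⟩

end SubspaceSum

section LinearForms

/-- `linToPoly` as a linear map. -/
noncomputable def linToPolyHom (F : Type*) [Field F] (n : ℕ) :
    Module.Dual F (Fin n → F) →ₗ[F] MvPolynomial (Fin n) F where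
  toFun := linToPoly
  map_add' φ ψ := by simp [linToPoly, add_mul, Finset.sum_add_distrib]
  map_smul' a φ := by simp [linToPoly, Finset.smul_sum, MvPolynomial.smul_eq_C_mul, mul_assoc]

lemma linToPolyHom_apply (φ : Module.Dual F (Fin n → F)) : linToPolyHom F n φ = linToPoly φ := rfl

lemma linToPoly_proj (k : Fin n) :
    linToPoly (LinearMap.proj k : Module.Dual F (Fin n → F)) = X k := by
  simp [linToPoly, Pi.single_apply]

lemma eval_linToPoly (φ : Module.Dual F (Fin n → F)) (v : Fin n → F) :
    eval v (linToPoly φ) = φ v := by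
  conv_rhs => rw [← (Pi.basisFun F (Fin n)).sum_repr v]
  simp [linToPoly, mul_comm]

lemma linToPoly_ne_zero {φ : Module.Dual F (Fin n → F)} (hφ : φ ≠ 0) : linToPoly φ ≠ 0 := by
  contrapose! hφ
  refine LinearMap.ext fun v => ?_
  rw [← eval_linToPoly, hφ, map_zero, LinearMap.zero_apply]

lemma ker_le_ker_of_linToPoly_dvd {φ ψ : Module.Dual F (Fin n → F)}
    (h : linToPoly φ ∣ linToPoly ψ) :
    LinearMap.ker φ ≤ LinearMap.ker ψ := by
  intro v hv
  obtain ⟨p, hp⟩ := h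
  rw [LinearMap.mem_ker, ← eval_linToPoly, hp, map_mul, eval_linToPoly, LinearMap.mem_ker.mp hv,
    zero_mul]

lemma irreducible_linToPoly {φ : Module.Dual F (Fin n → F)} (hφ : φ ≠ 0) :
    Irreducible (linToPoly φ) := by
  have hhom : (linToPoly φ).IsHomogeneous 1 :=
    MvPolynomial.IsHomogeneous.sum _ _ _ fun j _ => by
      simpa using (isHomogeneous_C (Fin n) (φ (Pi.single j 1))).mul (isHomogeneous_X F j)
  refine irreducible_of_totalDegree_eq_one (hhom.totalDegree (linToPoly_ne_zero hφ)) fun x hx => ?_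
  rw [isUnit_iff_ne_zero]
  rintro rfl
  exact linToPoly_ne_zero hφ (MvPolynomial.ext _ _ fun m => by simpa using hx m)

lemma exists_smul_eq_of_ker_le {V : Type*} [AddCommGroup V] [Module F V] {φ ψ : Module.Dual F V}
    (h : LinearMap.ker φ ≤ LinearMap.ker ψ) : ∃ a : F, ψ = a • φ := by
  by_cases hφ : φ = 0
  · refine ⟨0, LinearMap.ext fun v => ?_⟩
    have : v ∈ LinearMap.ker φ := by simp [hφ]
    simpa using h this
  · obtain ⟨v, hv⟩ : ∃ v, φ v ≠ 0 := by
      by_contra! h'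
      exact hφ (LinearMap.ext h')
    refine ⟨ψ v / φ v, LinearMap.ext fun w => ?_⟩
    have : w - (φ w / φ v) • v ∈ LinearMap.ker φ := by
      rw [LinearMap.mem_ker, map_sub, map_smul, smul_eq_mul]
      field_simp
      ring
    have := h this
    rw [LinearMap.mem_ker, map_sub, map_smul, smul_eq_mul, sub_eq_zero] at this
    rw [this, LinearMap.smul_apply, smul_eq_mul]
    field_simp

end LinearForms

section DicksonJacobian

open Finset

variable [Fintype F]

open Classical in
lemma dickson_eq_sum [Fintype (Submodule F (Fin n → F))] [Fintype (Module.Dual F (Fin n → F))]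
    (i : Fin n) : dickson F n i =
      ∑ W ∈ univ.filter (fun W : Submodule F (Fin n → F) => Module.finrank F W = n - (i : ℕ)),
        ∏ φ ∈ univ.filter (fun φ : Module.Dual F (Fin n → F) => ¬ W ≤ LinearMap.ker φ),
          linToPoly φ := by
  rw [dickson, finsum_cond_eq_sum_of_cond_iff (t := univ.filter
    fun W : Submodule F (Fin n → F) => Module.finrank F W = n - (i : ℕ)) _ (by simp)]
  exact Finset.sum_congr rfl fun W _ => finprod_cond_eq_prod_of_cond_iff _ (by simp)

open Classical in
lemma sum_prod_linToPoly [Fintype (Submodule F (Fin n → F))]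
    [Fintype (Module.Dual F (Fin n → F))] (k : Fin n) :
    ∑ W : Submodule F (Fin n → F),
      (∏ φ ∈ univ.filter (fun φ : Module.Dual F (Fin n → F) => ¬ W ≤ LinearMap.ker φ),
          linToPoly φ) * X k ^ Fintype.card F ^ (n - Module.finrank F W) = 0 := by
  let K := FractionRing (MvPolynomial (Fin n) F)
  let : Fintype (Submodule F (Module.Dual F (Fin n → F))) := Fintype.ofFinite _
  have hinj : Function.Injective (algebraMap (MvPolynomial (Fin n) F) K) :=
    IsFractionRing.injective _ _
  let ι : Module.Dual F (Fin n → F) →ₗ[F] K :=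
    (IsScalarTower.toAlgHom F (MvPolynomial (Fin n) F) K).toLinearMap ∘ₗ linToPolyHom F n
  have hι : ∀ φ, ι φ = algebraMap _ K (linToPoly φ) := fun _ => rfl
  have hproj : (LinearMap.proj k : Module.Dual F (Fin n → F)) ≠ 0 := fun h => by
    simpa using LinearMap.congr_fun h (Pi.single k 1)
  have h := sum_submodule_prod_compl ι hproj
  apply hinj
  rw [map_zero, ← h, map_sum]
  refine Fintype.sum_equiv
    ((Subspace.orderIsoFiniteDimensional (K := F) (V := Fin n → F)).toEquiv.trans
      OrderDual.ofDual) _ _ fun W => ?_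
  have hW : ((Subspace.orderIsoFiniteDimensional (K := F) (V := Fin n → F)).toEquiv.trans
      OrderDual.ofDual) W = W.dualAnnihilator := rfl
  rw [hW, map_mul, map_prod, map_pow, hι, linToPoly_proj]
  congr 2
  · ext φ
    simp [Submodule.mem_dualAnnihilator, SetLike.le_def]
  · have := Subspace.finrank_add_finrank_dualAnnihilator_eq W
    rw [Module.finrank_fin_fun] at this
    congr 1
    omega

lemma dickson_relation (k : Fin n) :
    ∑ i, dickson F n i * X k ^ Fintype.card F ^ (i : ℕ) + X k ^ Fintype.card F ^ n = 0 := by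
  classical
  let : Fintype (Submodule F (Fin n → F)) := Fintype.ofFinite _
  have : Finite (Module.Dual F (Fin n → F)) := Module.finite_of_finite F
  let : Fintype (Module.Dual F (Fin n → F)) := Fintype.ofFinite _
  have hle : ∀ W : Submodule F (Fin n → F), Module.finrank F W ≤ n := fun W => by
    simpa using W.finrank_le
  rw [← sum_prod_linToPoly (F := F) k, ← Finset.sum_fiberwise_of_maps_to (t := range (n + 1))
    (g := fun W : Submodule F (Fin n → F) => n - Module.finrank F W)
    (fun W _ => by rw [mem_range]; omega), Finset.sum_range_succ, Finset.sum_range]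
  congr 1
  · refine Finset.sum_congr rfl fun i _ => ?_
    rw [dickson_eq_sum, Finset.sum_mul]
    refine Finset.sum_congr (Finset.ext fun W => ?_) fun W hW => ?_
    · have := hle W
      simp only [mem_filter, mem_univ, true_and]
      omega
    · rw [(mem_filter.mp hW).2]
  · have : univ.filter (fun W : Submodule F (Fin n → F) => n - Module.finrank F W = n) = {⊥} := by
      ext W
      have := hle W
      rw [mem_filter, mem_singleton, ← Submodule.finrank_eq_zero (R := F)]
      simp only [mem_univ, true_and]
      have : 0 < n := k.pos
      omega
    rw [this, Finset.sum_singleton]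
    simp

/-- The Moore matrix `(x_k ^ (q ^ i))`. -/
noncomputable def mooreMat (F : Type*) [Field F] [Fintype F] (n : ℕ) :
    Matrix (Fin n) (Fin n) (MvPolynomial (Fin n) F) :=
  Matrix.of fun k i => X k ^ Fintype.card F ^ (i : ℕ)

/-- The Jacobian matrix of the Dickson invariants. -/
noncomputable def dicksonJac (F : Type*) [Field F] [Fintype F] (n : ℕ) :
    Matrix (Fin n) (Fin n) (MvPolynomial (Fin n) F) :=
  Matrix.of fun i j => pderiv j (dickson F n i)

lemma pderiv_pow_card (j : Fin n) (f : MvPolynomial (Fin n) F) {m : ℕ} (hm : m ≠ 0) :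
    pderiv j (f ^ Fintype.card F ^ m) = 0 := by
  have : ((Fintype.card F : ℕ) : MvPolynomial (Fin n) F) = 0 := by
    rw [← map_natCast (C : F →+* _), FiniteField.cast_card_eq_zero, map_zero]
  rw [pderiv_pow]
  simp [this, hm]

lemma mooreMat_mul_dicksonJac (hn : 0 < n) :
    mooreMat F n * dicksonJac F n = -dickson F n ⟨0, hn⟩ • 1 := by
  ext1 k j
  have h := congrArg (pderiv j) (dickson_relation (F := F) k)
  rw [map_zero, map_add, pderiv_pow_card j _ hn.ne', add_zero, map_sum] at h
  simp only [Derivation.leibniz, smul_eq_mul, Finset.sum_add_distrib] at h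
  rw [Finset.sum_eq_single (⟨0, hn⟩ : Fin n)] at h
  · simp only [mooreMat, dicksonJac, Matrix.mul_apply, Matrix.of_apply, Matrix.smul_apply,
      smul_eq_mul, Matrix.one_apply]
    rw [pow_zero, pow_one, pderiv_X] at h
    rw [eq_neg_of_add_eq_zero_right h, Pi.single_apply, neg_mul]
  · intro i _ hi
    rw [pderiv_pow_card j _ fun h0 => hi (Fin.ext h0), mul_zero]
  · simp

lemma det_mooreMat_mul_det_dicksonJac (hn : 0 < n) :
    (mooreMat F n).det * (dicksonJac F n).det = (-dickson F n ⟨0, hn⟩) ^ n := by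
  rw [← Matrix.det_mul, mooreMat_mul_dicksonJac hn, Matrix.det_smul]
  simp

lemma dickson_zero_eq (hn : 0 < n) (ℓ : Submodule F (Fin n → F) → Module.Dual F (Fin n → F))
    (hℓ : ∀ H : Submodule F (Fin n → F), Module.finrank F H = n - 1 →
      ℓ H ≠ 0 ∧ LinearMap.ker (ℓ H) = H) (s : Finset (Submodule F (Fin n → F)))
    (hs : ∀ H, H ∈ s ↔ Module.finrank F H = n - 1) :
    dickson F n ⟨0, hn⟩ = (-1) ^ s.card * (∏ H ∈ s, linToPoly (ℓ H)) ^ (Fintype.card F - 1) := by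
  classical
  let : Fintype (Submodule F (Fin n → F)) := Fintype.ofFinite _
  have : Finite (Module.Dual F (Fin n → F)) := Module.finite_of_finite F
  let : Fintype (Module.Dual F (Fin n → F)) := Fintype.ofFinite _
  have htop : univ.filter (fun W : Submodule F (Fin n → F) =>
      Module.finrank F W = n - ((⟨0, hn⟩ : Fin n) : ℕ)) = {⊤} := by
    ext W
    rw [mem_filter, mem_singleton]
    constructor
    · rintro ⟨-, h⟩
      exact Submodule.eq_top_of_finrank_eq (by simpa using h)
    · rintro rfl
      simp
  rw [dickson_eq_sum, htop, Finset.sum_singleton,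
    ← Finset.prod_fiberwise_of_maps_to (t := s) (g := fun φ => LinearMap.ker φ)]
  · rw [← Finset.prod_pow, ← Finset.prod_const, ← Finset.prod_mul_distrib]
    refine Finset.prod_congr rfl fun H hH => ?_
    obtain ⟨h0, hker⟩ := hℓ H ((hs H).mp hH)
    have : ∏ a : Fˣ, linToPolyHom F n ((a : F) • ℓ H) =
        -1 * linToPoly (ℓ H) ^ (Fintype.card F - 1) := by
      simp_rw [map_smul, smul_eq_C_mul]
      rw [Finset.prod_mul_distrib, Finset.prod_const, card_univ, Fintype.card_units, ← map_prod,
        ← Units.coe_prod, FiniteField.prod_univ_units_id_eq_neg_one]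
      simp [linToPolyHom_apply]
    rw [← this]
    symm
    refine Finset.prod_bij (fun a _ => (a : F) • ℓ H) ?_ ?_ ?_ fun _ _ => rfl
    · intro a _
      simp only [mem_filter, mem_univ, true_and, top_le_iff, LinearMap.ker_eq_top]
      refine ⟨smul_ne_zero a.ne_zero h0, ?_⟩
      rw [LinearMap.ker_smul _ _ a.ne_zero, hker]
    · intro a _ b _ hab
      exact Units.ext (smul_left_injective F h0 hab)
    · intro φ hφ
      simp only [mem_filter, mem_univ, true_and, top_le_iff, LinearMap.ker_eq_top] at hφ
      obtain ⟨a, rfl⟩ := exists_smul_eq_of_ker_le (φ := ℓ H) (ψ := φ) (by rw [hker, hφ.2])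
      exact ⟨Units.mk0 a fun ha => hφ.1 (by simp [ha]), mem_univ _, rfl⟩
  · intro φ hφ
    simp only [mem_filter, mem_univ, true_and, top_le_iff, LinearMap.ker_eq_top] at hφ
    have := Module.Dual.finrank_ker_add_one_of_ne_zero hφ
    rw [Module.finrank_fin_fun] at this
    exact (hs _).mpr (by omega)

lemma linToPoly_dvd_det_mooreMat {φ : Module.Dual F (Fin n → F)} (hφ : φ ≠ 0) :
    linToPoly φ ∣ (mooreMat F n).det := by
  obtain ⟨k, hk⟩ : ∃ k, φ (Pi.single k 1) ≠ 0 := by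
    by_contra! h
    exact hφ ((Pi.basisFun F (Fin n)).ext fun k => by simpa using h k)
  have h := Matrix.det_updateRow_sum (mooreMat F n) k fun j => C (φ (Pi.single j 1))
  have hrow : (∑ j, (C (φ (Pi.single j 1)) : MvPolynomial (Fin n) F) • mooreMat F n j) =
      linToPoly φ • fun i : Fin n => linToPoly φ ^ (Fintype.card F ^ (i : ℕ) - 1) := by
    ext1 i
    have hi : Fintype.card F ^ (i : ℕ) ≠ 0 := pow_ne_zero _ Fintype.card_ne_zero
    have hfrob : ∀ m : ℕ, ∀ c : Fin n → F, (∑ j, C (c j) * X j : MvPolynomial (Fin n) F) ^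
        Fintype.card F ^ m = ∑ j, C (c j) * X j ^ Fintype.card F ^ m := by
      intro m c
      induction m with
      | zero => simp
      | succ m ih =>
        rw [pow_succ, pow_mul, ih]
        refine (map_sum (FiniteField.frobeniusAlgHom F (MvPolynomial (Fin n) F)) _ _).trans ?_
        refine Finset.sum_congr rfl fun j _ => ?_
        simp only [FiniteField.coe_frobeniusAlgHom]
        rw [mul_pow, ← map_pow, FiniteField.pow_card, ← pow_mul]
    rw [Pi.smul_apply, smul_eq_mul, mul_pow_sub_one hi, linToPoly, hfrob]
    simp [mooreMat]
  rw [hrow, Matrix.det_updateRow_smul, smul_eq_mul] at h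
  refine ((isUnit_iff_ne_zero.mpr hk).map C).dvd_mul_left.mp ?_
  rw [← h]
  exact dvd_mul_right _ _

end DicksonJacobian

section Action

lemma polyAct_X (g : GLn F n) (i : Fin n) :
    polyAct g (X i) = ∑ j, C (actMat g i j) * X j := by
  simp [polyAct]

lemma polyAct_C (g : GLn F n) (a : F) : polyAct g (C a) = C a := (polyAct g).commutes a

lemma polyAct_X_eq_linToPoly (g : GLn F n) (i : Fin n) :
    polyAct g (X i) = linToPoly (LinearMap.proj i ∘ₗ (g.symm : (Fin n → F) →ₗ[F] Fin n → F)) := by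
  simp [polyAct_X, linToPoly, actMat]

lemma sum_smul_apply_single {V : Type*} [AddCommGroup V] [Module F V] (f : (Fin n → F) →ₗ[F] V)
    (v : Fin n → F) : ∑ i, v i • f (Pi.single i 1) = f v := by
  conv_rhs => rw [← (Pi.basisFun F (Fin n)).sum_repr v]
  simp

lemma polyAct_linToPoly (g : GLn F n) (φ : Module.Dual F (Fin n → F)) :
    polyAct g (linToPoly φ) = linToPoly (φ ∘ₗ (g.symm : (Fin n → F) →ₗ[F] Fin n → F)) := by
  simp only [linToPoly, map_sum, map_mul, polyAct_C, polyAct_X, Finset.mul_sum]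
  rw [Finset.sum_comm]
  refine Finset.sum_congr rfl fun j _ => ?_
  simp_rw [← mul_assoc, ← C_mul, ← Finset.sum_mul, ← map_sum]
  congr 2
  rw [LinearMap.comp_apply, ← sum_smul_apply_single φ]
  simp [actMat, mul_comm]

/-- The contraction of the 1-form `ω` with the constant vector field `v`. -/
noncomputable def contract (ω : Fin n → MvPolynomial (Fin n) F) :
    (Fin n → F) →ₗ[F] MvPolynomial (Fin n) F where
  toFun v := ∑ j, v j • ω j
  map_add' v w := by simp [add_smul, Finset.sum_add_distrib]
  map_smul' a v := by simp [Finset.smul_sum, mul_smul]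

lemma contract_apply (ω : Fin n → MvPolynomial (Fin n) F) (v : Fin n → F) :
    contract ω v = ∑ j, v j • ω j := rfl

lemma contract_single (ω : Fin n → MvPolynomial (Fin n) F) (j : Fin n) :
    contract ω (Pi.single j 1) = ω j := by
  simp [contract_apply, Pi.single_apply]

lemma contract_oneFormAct (g : GLn F n) (ω : Fin n → MvPolynomial (Fin n) F) (v : Fin n → F) :
    contract (oneFormAct g ω) (g v) = polyAct g (contract ω v) := by
  simp only [contract_apply, oneFormAct, map_sum, map_smul, Finset.smul_sum]
  rw [Finset.sum_comm]
  refine Finset.sum_congr rfl fun i _ => ?_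
  have h := congrFun (sum_smul_apply_single (g.symm : (Fin n → F) →ₗ[F] Fin n → F) (g v)) i
  rw [LinearEquiv.coe_coe, LinearEquiv.symm_apply_apply, Finset.sum_apply] at h
  rw [← h, Finset.sum_smul]
  refine Finset.sum_congr rfl fun j _ => ?_
  simp only [Pi.smul_apply, smul_eq_mul, actMat, Matrix.of_apply, smul_eq_C_mul, C_mul]
  ring

lemma linToPoly_dvd_polyAct_sub (φ : Module.Dual F (Fin n → F)) (g : GLn F n)
    (hg : ∀ v ∈ LinearMap.ker φ, g v = v) (f : MvPolynomial (Fin n) F) :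
    linToPoly φ ∣ polyAct g f - f := by
  let I := Ideal.span {linToPoly φ}
  have h : (Ideal.Quotient.mkₐ F I).comp (polyAct g) = Ideal.Quotient.mkₐ F I := by
    refine MvPolynomial.algHom_ext fun i => ?_
    rw [AlgHom.comp_apply, Ideal.Quotient.mkₐ_eq_mk, Ideal.Quotient.eq, Ideal.mem_span_singleton,
      polyAct_X_eq_linToPoly, ← linToPoly_proj i]
    obtain ⟨a, ha⟩ := exists_smul_eq_of_ker_le (φ := φ)
      (ψ := LinearMap.proj i ∘ₗ (g.symm : (Fin n → F) →ₗ[F] Fin n → F) - LinearMap.proj i)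
      fun v hv => by
        have : g.symm v = v := by rw [LinearEquiv.symm_apply_eq, hg v hv]
        simp [this]
    simp only [← linToPolyHom_apply]
    rw [← map_sub, ha, map_smul, smul_eq_C_mul]
    exact dvd_mul_left _ _
  have := AlgHom.congr_fun h f
  rwa [AlgHom.comp_apply, Ideal.Quotient.mkₐ_eq_mk, Ideal.Quotient.eq,
    Ideal.mem_span_singleton] at this

/-- The transvection `v ↦ v + φ v • h`. -/
def shear (φ : Module.Dual F (Fin n → F)) (h : Fin n → F) (hh : φ h = 0) : GLn F n :=
  LinearEquiv.ofLinearMap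
    (LinearMap.id + φ.smulRight h) (LinearMap.id - φ.smulRight h)
    (LinearMap.ext fun v => by simp [hh]) (LinearMap.ext fun v => by simp [hh])

lemma shear_apply (φ : Module.Dual F (Fin n → F)) (h : Fin n → F) (hh : φ h = 0)
    (v : Fin n → F) : shear φ h hh v = v + φ v • h := rfl

/-- The homothety `v ↦ v + (t - 1) φ v • w`, which scales `w` by `t` and fixes `ker φ`. -/
def homothety (φ : Module.Dual F (Fin n → F)) (w : Fin n → F) (hw : φ w = 1) (t : Fˣ) :
    GLn F n :=
  LinearEquiv.ofLinearMap
    (LinearMap.id + φ.smulRight (((t : F) - 1) • w))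
    (LinearMap.id + φ.smulRight ((((t⁻¹ : Fˣ) : F) - 1) • w))
    (LinearMap.ext fun v => by
      ext i
      simp [hw]
      field_simp
      ring)
    (LinearMap.ext fun v => by
      ext i
      simp [hw]
      field_simp
      ring)

lemma homothety_apply (φ : Module.Dual F (Fin n → F)) (w : Fin n → F) (hw : φ w = 1) (t : Fˣ)
    (v : Fin n → F) : homothety φ w hw t v = v + φ v • (((t : F) - 1) • w) := rfl

lemma homothety_symm_apply (φ : Module.Dual F (Fin n → F)) (w : Fin n → F) (hw : φ w = 1) (t : Fˣ)
    (v : Fin n → F) :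
    (homothety φ w hw t).symm v = v + φ v • ((((t⁻¹ : Fˣ) : F) - 1) • w) := rfl

lemma homothety_apply_of_mem_ker {φ : Module.Dual F (Fin n → F)} {w : Fin n → F} (hw : φ w = 1)
    (t : Fˣ) {v : Fin n → F} (hv : v ∈ LinearMap.ker φ) : homothety φ w hw t v = v := by
  rw [homothety_apply, LinearMap.mem_ker.mp hv, zero_smul, add_zero]

lemma homothety_apply_self {φ : Module.Dual F (Fin n → F)} {w : Fin n → F} (hw : φ w = 1)
    (t : Fˣ) : homothety φ w hw t w = (t : F) • w := by
  rw [homothety_apply, hw, one_smul, sub_smul, one_smul, add_sub_cancel]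

lemma polyAct_homothety_linToPoly {φ : Module.Dual F (Fin n → F)} {w : Fin n → F} (hw : φ w = 1)
    (t : Fˣ) :
    polyAct (homothety φ w hw t) (linToPoly φ) = C ((t⁻¹ : Fˣ) : F) * linToPoly φ := by
  rw [polyAct_linToPoly, ← smul_eq_C_mul, ← linToPolyHom_apply φ, ← map_smul, linToPolyHom_apply]
  congr 1
  refine LinearMap.ext fun v => ?_
  rw [LinearMap.comp_apply, LinearEquiv.coe_coe, homothety_symm_apply, map_add, map_smul, map_smul,
    hw, LinearMap.smul_apply]
  simp only [smul_eq_mul]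
  ring

lemma linToPoly_dvd_contract {ω : Fin n → MvPolynomial (Fin n) F}
    (hω : ∀ g : GLn F n, oneFormAct g ω = ω) {φ : Module.Dual F (Fin n → F)} {w h : Fin n → F}
    (hw : φ w = 1) (hh : φ h = 0) : linToPoly φ ∣ contract ω h := by
  have key := contract_oneFormAct (shear φ h hh) ω w
  rw [hω, shear_apply, hw, one_smul, map_add] at key
  have hd := linToPoly_dvd_polyAct_sub φ (shear φ h hh)
    (fun v hv => by rw [shear_apply, LinearMap.mem_ker.mp hv, zero_smul, add_zero]) (contract ω w)
  rwa [← key, add_sub_cancel_left] at hd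

lemma linToPoly_pow_succ_dvd [Fintype F] {φ : Module.Dual F (Fin n → F)} {w : Fin n → F}
    (hw : φ w = 1) {f : MvPolynomial (Fin n) F} {k a : ℕ}
    (hf : ∀ t : Fˣ, polyAct (homothety φ w hw t) f = C ((t : F) ^ k) * f)
    (hk : ¬ (Fintype.card F - 1) ∣ k + a) (ha : linToPoly φ ^ a ∣ f) :
    linToPoly φ ^ (a + 1) ∣ f := by
  classical
  have hφ : φ ≠ 0 := by
    rintro rfl
    simp at hw
  have hL := linToPoly_ne_zero hφ
  obtain ⟨f', rfl⟩ := ha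
  obtain ⟨t, ht⟩ := IsCyclic.exists_generator (α := Fˣ)
  have hord : (t : F) ^ (k + a) - 1 ≠ 0 := by
    rw [sub_ne_zero, ← Units.val_pow_eq_pow_val, Ne, Units.val_eq_one, ← orderOf_dvd_iff_pow_eq_one,
      orderOf_eq_card_of_forall_mem_zpowers ht, Nat.card_eq_fintype_card, Fintype.card_units]
    exact hk
  have hact : polyAct (homothety φ w hw t) f' = C ((t : F) ^ (k + a)) * f' := by
    have h1 := hf t
    rw [map_mul, map_pow, polyAct_homothety_linToPoly, mul_pow] at h1
    refine mul_left_cancel₀ (pow_ne_zero a hL) ?_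
    have ht1 : (C (t : F) * C ((t⁻¹ : Fˣ) : F) : MvPolynomial (Fin n) F) = 1 := by
      rw [← C_mul, Units.mul_inv, C_1]
    calc linToPoly φ ^ a * polyAct (homothety φ w hw t) f'
        = C (t : F) ^ a * (C ((t⁻¹ : Fˣ) : F) ^ a * linToPoly φ ^ a *
            polyAct (homothety φ w hw t) f') := by
          rw [← mul_assoc, ← mul_assoc, ← mul_pow, ht1, one_pow, one_mul]
      _ = linToPoly φ ^ a * (C ((t : F) ^ (k + a)) * f') := by
          rw [h1, pow_add, C_mul, ← C_pow]
          ring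
  have hd := linToPoly_dvd_polyAct_sub φ (homothety φ w hw t)
    (fun v hv => homothety_apply_of_mem_ker hw t hv) f'
  rw [hact, ← sub_one_mul, ← C_1, ← C_sub] at hd
  rw [pow_succ]
  refine mul_dvd_mul_left _ ?_
  have hu : IsUnit (C ((t : F) ^ (k + a) - 1) : MvPolynomial (Fin n) F) :=
    (isUnit_iff_ne_zero.mpr hord).map C
  exact hu.dvd_mul_left.mp hd

lemma linToPoly_pow_dvd_contract_of_mem_ker [Fintype F] {ω : Fin n → MvPolynomial (Fin n) F}
    (hω : ∀ g : GLn F n, oneFormAct g ω = ω) {φ : Module.Dual F (Fin n → F)} {w h : Fin n → F}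
    (hw : φ w = 1) (hh : φ h = 0) : linToPoly φ ^ (Fintype.card F - 1) ∣ contract ω h := by
  have hq : 1 < Fintype.card F := Fintype.one_lt_card
  have key : ∀ a, 1 ≤ a → a ≤ Fintype.card F - 1 → linToPoly φ ^ a ∣ contract ω h := by
    intro a ha
    induction a, ha using Nat.le_induction with
    | base => exact fun _ => by simpa using linToPoly_dvd_contract hω hw hh
    | succ a ha ih =>
      intro hle
      refine linToPoly_pow_succ_dvd (k := 0) hw (fun t => ?_) (fun hdvd => ?_) (ih (by omega))
      · rw [← contract_oneFormAct, hω, homothety_apply_of_mem_ker hw t hh, pow_zero, C_1, one_mul]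
      · have := Nat.le_of_dvd (by omega) hdvd
        omega
  exact key _ (by omega) le_rfl

lemma linToPoly_pow_dvd_contract [Fintype F] {ω : Fin n → MvPolynomial (Fin n) F}
    (hω : ∀ g : GLn F n, oneFormAct g ω = ω) {φ : Module.Dual F (Fin n → F)} {w : Fin n → F}
    (hw : φ w = 1) : linToPoly φ ^ (Fintype.card F - 2) ∣ contract ω w := by
  have key : ∀ a, a ≤ Fintype.card F - 2 → linToPoly φ ^ a ∣ contract ω w := by
    intro a
    induction a with
    | zero => simp
    | succ a ih =>
      intro hle
      refine linToPoly_pow_succ_dvd (k := 1) hw (fun t => ?_) (fun hdvd => ?_) (ih (by omega))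
      · rw [← contract_oneFormAct, hω, homothety_apply_self, map_smul, pow_one, smul_eq_C_mul]
      · have := Nat.le_of_dvd (by omega) hdvd
        omega
  exact key _ le_rfl

lemma linToPoly_pow_dvd_det [Fintype F] {A : Matrix (Fin n) (Fin n) (MvPolynomial (Fin n) F)}
    (hA : ∀ i, ∀ g : GLn F n, oneFormAct g (A i) = A i) {φ : Module.Dual F (Fin n → F)}
    (hφ : φ ≠ 0) :
    linToPoly φ ^ ((n - 1) * (Fintype.card F - 1) + (Fintype.card F - 2)) ∣ A.det := by
  obtain ⟨j₀, hj₀⟩ : ∃ j, φ (Pi.single j 1) ≠ 0 := by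
    by_contra! h
    exact hφ (LinearMap.ext fun v => by simp [← sum_smul_apply_single φ v, h])
  let u : Fin n → Fin n → F := fun j => if j = j₀ then Pi.single j₀ 1 else
    Pi.single j 1 - (φ (Pi.single j 1) / φ (Pi.single j₀ 1)) • Pi.single j₀ 1
  let B : Matrix (Fin n) (Fin n) (MvPolynomial (Fin n) F) :=
    Matrix.of fun i j => contract (A i) (u j)
  let m : Fin n → ℕ := fun j => if j = j₀ then Fintype.card F - 2 else Fintype.card F - 1
  have hAB : A.det = B.det := by
    rw [← Matrix.det_transpose A, ← Matrix.det_transpose B]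
    symm
    refine Matrix.det_eq_of_forall_row_eq_smul_add_const
      (fun j => if j = j₀ then 0 else - C (φ (Pi.single j 1) / φ (Pi.single j₀ 1))) j₀
      (by simp) fun j i => ?_
    by_cases hj : j = j₀
    · subst hj
      simp [B, u, contract_single]
    · simp [B, u, hj, contract_single, smul_eq_C_mul, sub_eq_add_neg]
  have hcol : ∀ i j, linToPoly φ ^ m j ∣ B i j := by
    intro i j
    have hw : φ ((φ (Pi.single j₀ 1))⁻¹ • Pi.single j₀ 1) = 1 := by simp [hj₀]
    by_cases hj : j = j₀
    · have := linToPoly_pow_dvd_contract (hA i) hw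
      rw [map_smul, smul_eq_C_mul, IsUnit.dvd_mul_left
        ((isUnit_iff_ne_zero.mpr (inv_ne_zero hj₀)).map C)] at this
      simpa [B, u, m, hj] using this
    · have := linToPoly_pow_dvd_contract_of_mem_ker (hA i) hw (h := u j) (by simp [u, hj, hj₀])
      simpa [B, m, hj] using this
  choose Q hQ using hcol
  have hB : B = Matrix.of fun i j => linToPoly φ ^ m j * Matrix.of Q i j := by
    ext1 i j
    exact hQ i j
  have hm : ∑ j, m j = (n - 1) * (Fintype.card F - 1) + (Fintype.card F - 2) := by
    rw [← Finset.sum_erase_add _ _ (Finset.mem_univ j₀), Finset.sum_congr rfl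
      fun j hj => if_neg (Finset.ne_of_mem_erase hj)]
    simp [m]
  rw [hAB, hB, Matrix.det_mul_row, Finset.prod_pow_eq_pow_sum, hm]
  exact dvd_mul_right _ _

end Action

section Invariance

lemma pderiv_polyAct (g : GLn F n) (f : MvPolynomial (Fin n) F) (j : Fin n) :
    pderiv j (polyAct g f) = ∑ i, polyAct g (pderiv i f) * C (actMat g i j) := by
  induction f using MvPolynomial.induction_on with
  | C a => simp
  | add p q hp hq => simp [hp, hq, add_mul, Finset.sum_add_distrib]
  | mul_X p k hp =>
    have hX : pderiv j (polyAct g (X k)) = C (actMat g k j) := by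
      simp [polyAct_X, pderiv_X, Pi.single_apply]
    rw [map_mul, Derivation.leibniz, hX, hp]
    simp only [Derivation.leibniz, pderiv_X, smul_eq_mul, map_add, map_mul, add_mul,
      Finset.sum_add_distrib]
    congr 1
    · simp [Pi.single_apply, apply_ite (polyAct g)]
    · rw [Finset.mul_sum]
      exact Finset.sum_congr rfl fun i _ => (mul_assoc _ _ _).symm

lemma oneFormAct_pderiv (g : GLn F n) (f : MvPolynomial (Fin n) F) :
    oneFormAct g (fun j => pderiv j f) = fun j => pderiv j (polyAct g f) :=
  funext fun j => (pderiv_polyAct g f j).symm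

lemma polyAct_dickson [Fintype F] (g : GLn F n) (i : Fin n) :
    polyAct g (dickson F n i) = dickson F n i := by
  classical
  let : Fintype (Submodule F (Fin n → F)) := Fintype.ofFinite _
  have : Finite (Module.Dual F (Fin n → F)) := Module.finite_of_finite F
  let : Fintype (Module.Dual F (Fin n → F)) := Fintype.ofFinite _
  rw [dickson_eq_sum, map_sum]
  refine Finset.sum_equiv (Submodule.orderIsoMapComap g).toEquiv (fun W => ?_) fun W _ => ?_
  · simp [Submodule.orderIsoMapComap_apply, LinearEquiv.finrank_map_eq]
  · rw [map_prod]
    refine Finset.prod_equiv g.symm.dualMap.toEquiv (fun φ => ?_) fun φ _ => ?_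
    · simpa [Submodule.orderIsoMapComap_apply, SetLike.le_def] using g.symm.surjective.exists
    · exact polyAct_linToPoly g φ

lemma oneFormAct_dicksonJac [Fintype F] (g : GLn F n) (i : Fin n) :
    oneFormAct g (dicksonJac F n i) = dicksonJac F n i := by
  refine (oneFormAct_pderiv g (dickson F n i)).trans ?_
  rw [polyAct_dickson]
  rfl

end Invariance

section JacobianDeterminant

lemma prod_linToPoly_pow_dvd {ℓ : Submodule F (Fin n → F) → Module.Dual F (Fin n → F)}
    (hℓ : ∀ H : Submodule F (Fin n → F), Module.finrank F H = n - 1 →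
      ℓ H ≠ 0 ∧ LinearMap.ker (ℓ H) = H) {s : Finset (Submodule F (Fin n → F))}
    (hs : ∀ H, H ∈ s ↔ Module.finrank F H = n - 1) {e : ℕ} {f : MvPolynomial (Fin n) F}
    (hf : ∀ H ∈ s, linToPoly (ℓ H) ^ e ∣ f) : (∏ H ∈ s, linToPoly (ℓ H)) ^ e ∣ f := by
  rw [← Finset.prod_pow]
  refine Finset.prod_dvd_of_isRelPrime (fun H hH H' hH' hne => ?_) hf
  rw [Finset.mem_coe, hs] at hH hH'
  refine IsRelPrime.pow ?_
  rw [(irreducible_linToPoly (hℓ H hH).1).isRelPrime_iff_not_dvd]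
  intro hdvd
  have hle := ker_le_ker_of_linToPoly_dvd hdvd
  rw [(hℓ H hH).2, (hℓ H' hH').2] at hle
  exact hne (Submodule.eq_of_le_of_finrank_eq hle (hH.trans hH'.symm))

variable [Fintype F]

lemma exists_det_dicksonJac_eq (hn : 0 < n)
    {ℓ : Submodule F (Fin n → F) → Module.Dual F (Fin n → F)}
    (hℓ : ∀ H : Submodule F (Fin n → F), Module.finrank F H = n - 1 →
      ℓ H ≠ 0 ∧ LinearMap.ker (ℓ H) = H) {s : Finset (Submodule F (Fin n → F))}
    (hs : ∀ H, H ∈ s ↔ Module.finrank F H = n - 1) :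
    ∃ c : F, c ≠ 0 ∧ (dicksonJac F n).det = C c * (∏ H ∈ s, linToPoly (ℓ H)) ^
      ((n - 1) * (Fintype.card F - 1) + (Fintype.card F - 2)) := by
  have hq : 1 < Fintype.card F := Fintype.one_lt_card
  set e := (n - 1) * (Fintype.card F - 1) + (Fintype.card F - 2) with he
  set P := ∏ H ∈ s, linToPoly (ℓ H) with hPdef
  have hP : P ≠ 0 :=
    Finset.prod_ne_zero_iff.mpr fun H hH => linToPoly_ne_zero (hℓ H ((hs H).mp hH)).1
  have hdeg : (Fintype.card F - 1) * n = 1 + e := by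
    obtain ⟨m, rfl⟩ := Nat.exists_eq_add_of_lt hn
    obtain ⟨r, hr⟩ := Nat.exists_eq_add_of_lt hq
    rw [he, hr]
    simp only [zero_add, Nat.add_sub_cancel, show 1 + r + 1 - 1 = r + 1 by omega,
      show 1 + r + 1 - 2 = r by omega]
    ring
  obtain ⟨a, ha⟩ : P ∣ (mooreMat F n).det := by
    simpa using prod_linToPoly_pow_dvd hℓ hs (e := 1) fun H hH => by
      simpa using linToPoly_dvd_det_mooreMat (hℓ H ((hs H).mp hH)).1
  obtain ⟨b, hb⟩ : P ^ e ∣ (dicksonJac F n).det :=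
    prod_linToPoly_pow_dvd hℓ hs fun H hH =>
      linToPoly_pow_dvd_det (fun i g => oneFormAct_dicksonJac g i) (hℓ H ((hs H).mp hH)).1
  have hab : P ^ (1 + e) * (a * b) = P ^ (1 + e) * (-(-1) ^ s.card) ^ n := by
    calc P ^ (1 + e) * (a * b) = (mooreMat F n).det * (dicksonJac F n).det := by
          rw [ha, hb]
          ring
      _ = P ^ (1 + e) * (-(-1) ^ s.card) ^ n := by
          rw [det_mooreMat_mul_det_dicksonJac hn, dickson_zero_eq hn ℓ hℓ s hs, ← hdeg, pow_mul P,
            ← neg_mul, mul_pow, mul_comm]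
  have hunit : IsUnit (a * b) := by
    rw [mul_left_cancel₀ (pow_ne_zero _ hP) hab]
    exact ((isUnit_one.neg.pow _).neg).pow _
  obtain ⟨c, hc, rfl⟩ := isUnit_iff_eq_C_of_isReduced.mp (isUnit_of_mul_isUnit_right hunit)
  exact ⟨c, hc.ne_zero, by rw [hb, mul_comm]⟩

end JacobianDeterminant

section Freeness

/-- If the determinant of a matrix of invariant 1-forms divides the determinant of every matrix of
invariant 1-forms, then its rows freely generate the invariant 1-forms over the invariant ring. -/
lemma existsUnique_sum_mul_of_det_dvd_det {J : Matrix (Fin n) (Fin n) (MvPolynomial (Fin n) F)}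
    (hJ : ∀ i, ∀ g : GLn F n, oneFormAct g (J i) = J i) (hdet : J.det ≠ 0)
    (hdvd : ∀ A : Matrix (Fin n) (Fin n) (MvPolynomial (Fin n) F),
      (∀ i, ∀ g : GLn F n, oneFormAct g (A i) = A i) → J.det ∣ A.det)
    {ω : Fin n → MvPolynomial (Fin n) F} (hω : ∀ g : GLn F n, oneFormAct g ω = ω) :
    ∃! h : Fin n → MvPolynomial (Fin n) F,
      (∀ i, ∀ g : GLn F n, polyAct g (h i) = h i) ∧ ∀ j, ω j = ∑ i, h i * J i j := by
  have huniq : ∀ h h' : Fin n → MvPolynomial (Fin n) F,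
      (∀ j, ∑ i, h i * J i j = ∑ i, h' i * J i j) → h = h' := fun h h' heq =>
    sub_eq_zero.mp (Matrix.eq_zero_of_vecMul_eq_zero hdet (by
      rw [Matrix.sub_vecMul, sub_eq_zero]
      exact funext heq))
  have hrow : ∀ i, J.det ∣ (J.updateRow i ω).det := fun i => by
    refine hdvd _ fun k g => ?_
    by_cases hk : k = i
    · subst hk
      rw [Matrix.updateRow_self, hω]
    · rw [Matrix.updateRow_ne hk, hJ]
  choose h hh using hrow
  have hsum : ∀ j, ω j = ∑ i, h i * J i j := fun j => by
    refine mul_left_cancel₀ hdet ?_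
    have hc := congrFun (Matrix.mulVec_cramer J.transpose ω) j
    rw [Matrix.det_transpose, Pi.smul_apply, smul_eq_mul] at hc
    rw [← hc, Matrix.mulVec, dotProduct, Finset.mul_sum]
    refine Finset.sum_congr rfl fun i _ => ?_
    rw [Matrix.cramer_transpose_apply, hh, Matrix.transpose_apply]
    ring
  refine ⟨h, ⟨fun i g => ?_, hsum⟩, fun h' hh' => huniq _ _ fun j => ?_⟩
  · refine congrFun (huniq (fun i => polyAct g (h i)) h fun j => ?_) i
    rw [← hsum j, ← congrFun (hω g) j, oneFormAct]
    simp_rw [hsum, map_sum, map_mul, Finset.sum_mul]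
    rw [Finset.sum_comm]
    refine Finset.sum_congr rfl fun k _ => ?_
    rw [← congrFun (hJ k g) j, oneFormAct, Finset.mul_sum]
    simp_rw [mul_assoc]
  · rw [← hsum j, ← hh'.2 j]

end Freeness

/-- the Jacobian determinant of the Dickson invariants equals, up to a
nonzero scalar, `∏_H l_H^{(n-1)(q-1)+(q-2)}` over all hyperplanes `H`, and the exterior
derivatives of the Dickson invariants freely generate `(Ω¹)^{GL_n(F_q)}` over the
Dickson algebra `F_q[V]^{GL_n(F_q)}`. -/
theorem stmt18 {F : Type*} [Field F] [Fintype F] (h2 : ringChar F ≠ 2) {n : ℕ}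
    (ℓ : Submodule F (Fin n → F) → ((Fin n → F) →ₗ[F] F))
    (hℓ : ∀ H : Submodule F (Fin n → F), Module.finrank F H = n - 1 →
      ℓ H ≠ 0 ∧ LinearMap.ker (ℓ H) = H) :
    (∃ c : F, c ≠ 0 ∧
      Matrix.det (Matrix.of fun i j : Fin n => pderiv j (dickson F n i)) =
        C c * ∏ᶠ (H : Submodule F (Fin n → F)) (_ : Module.finrank F H = n - 1),
          linToPoly (ℓ H) ^ ((n - 1) * (Fintype.card F - 1) + (Fintype.card F - 2))) ∧
    ∀ ω : Fin n → MvPolynomial (Fin n) F, (∀ g : GLn F n, oneFormAct g ω = ω) →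
      ∃! h : Fin n → MvPolynomial (Fin n) F,
        (∀ i, ∀ g : GLn F n, polyAct g (h i) = h i) ∧
        ∀ j, ω j = ∑ i, h i * pderiv j (dickson F n i) := by
  have hn : 0 < n := by
    refine Nat.pos_of_ne_zero fun hn => ?_
    subst hn
    exact (hℓ ⊥ (by simp)).1 (Subsingleton.elim _ _)
  let : Fintype (Submodule F (Fin n → F)) := Fintype.ofFinite _
  classical
  obtain ⟨s, hs⟩ : ∃ s : Finset (Submodule F (Fin n → F)),
      ∀ H, H ∈ s ↔ Module.finrank F H = n - 1 :=
    ⟨Finset.univ.filter fun H => Module.finrank F H = n - 1, by simp⟩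
  obtain ⟨c, hc, hdet⟩ := exists_det_dicksonJac_eq hn hℓ hs
  refine ⟨⟨c, hc, ?_⟩, fun ω hω => ?_⟩
  · rw [finprod_cond_eq_prod_of_cond_iff (t := s) _ fun _ => (hs _).symm, Finset.prod_pow]
    exact hdet
  · refine existsUnique_sum_mul_of_det_dvd_det (J := dicksonJac F n)
      (fun i g => oneFormAct_dicksonJac g i) ?_ (fun A hA => ?_) hω
    · rw [hdet]
      exact mul_ne_zero (C_ne_zero.mpr hc) (pow_ne_zero _ (Finset.prod_ne_zero_iff.mpr fun H hH =>
        linToPoly_ne_zero (hℓ H ((hs H).mp hH)).1))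
    · rw [hdet, ((isUnit_iff_ne_zero.mpr hc).map C).mul_left_dvd]
      exact prod_linToPoly_pow_dvd hℓ hs fun H hH =>
        linToPoly_pow_dvd_det hA (hℓ H ((hs H).mp hH)).1
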